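/- arXiv:1107.5348 — 2 statements merged into one kernel-verified Lean document; each statement's English description precedes it below -/
import Mathlib

section
/- Let (X, μ) be a probability space and let α, β, γ be finite measurable partitions of X such that β is a refinement of α. If there exist a cell C ∈ γ and two distinct cells B_1, B_2 ∈ β contained in the same cell A ∈ α with μ(B_1 ∩ C) > 0 and μ(B_2 ∩ C) > 0, then H(α|γ) < H(β|γ). -/
open MeasureTheory Finset Real

variable {X : Type*} [MeasurableSpace X]

/-- A finite measurable partition of `X` with respect to the measure space structure:
a finite collection of pairwise disjoint measurable subsets of `X` whose union is `X`. -/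
def IsFinPartition (α : Finset (Set X)) : Prop :=
  (∀ A ∈ α, MeasurableSet A) ∧
  (α : Set (Set X)).PairwiseDisjoint id ∧
  ⋃₀ (α : Set (Set X)) = Set.univ

/-- The partition entropy `H(α) = −Σ_A μ(A) log₂ μ(A)` (convention `0 · log₂ 0 = 0`). -/
noncomputable def partEntropy (μ : Measure X) (α : Finset (Set X)) : ℝ :=
  -∑ A ∈ α, (μ A).toReal * Real.logb 2 (μ A).toReal

/-- The conditional partition entropy
`H(α|β) = −Σ_{A∈α} Σ_{B∈β} μ(A∩B) log₂(μ(A∩B)/μ(B))`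
(with the convention `0 · log₂ 0 = 0`; cells `B` with `μ(B) = 0` contribute `0`). -/
noncomputable def condEntropy (μ : Measure X) (α β : Finset (Set X)) : ℝ :=
  -∑ A ∈ α, ∑ B ∈ β,
    (μ (A ∩ B)).toReal * Real.logb 2 ((μ (A ∩ B)).toReal / (μ B).toReal)

/-- `β` refines `α`: every cell of `α` is a union of cells of `β`. -/
def Refines (β α : Finset (Set X)) : Prop :=
  ∀ A ∈ α, ∃ s : Finset (Set X), s ⊆ β ∧ A = ⋃₀ (s : Set (Set X))

open Classical in
/-- Nonempty cells of `β` inside `A`. -/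
noncomputable def cellsIn (β : Finset (Set X)) (A : Set X) : Finset (Set X) :=
  β.filter (fun B => B.Nonempty ∧ B ⊆ A)

theorem mem_cellsIn_iff (β : Finset (Set X)) (A B : Set X) :
    B ∈ cellsIn β A ↔ B ∈ β ∧ B.Nonempty ∧ B ⊆ A := by
  simp [cellsIn]

theorem exists_cell_of_mem {α β : Finset (Set X)} (href : Refines β α)
    {A : Set X} (hA : A ∈ α) {x : X} (hx : x ∈ A) : ∃ B ∈ cellsIn β A, x ∈ B := by
  obtain ⟨s, hs, rfl⟩ := href A hA
  obtain ⟨B, hB, hxB⟩ := hx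
  exact ⟨B, (mem_cellsIn_iff _ _ _).2 ⟨hs hB, ⟨x, hxB⟩, Set.subset_sUnion_of_mem hB⟩, hxB⟩

theorem cell_eq_of_mem {β : Finset (Set X)} (hβ : IsFinPartition β) {B B' : Set X}
    (hB : B ∈ β) (hB' : B' ∈ β) {x : X} (hx : x ∈ B) (hx' : x ∈ B') : B = B' := by
  by_contra hne
  exact Set.disjoint_left.1 (hβ.2.1 hB hB' hne) hx hx'

theorem sum_cells_eq {α β : Finset (Set X)} (hα : IsFinPartition α) (hβ : IsFinPartition β)
    (href : Refines β α) (F : Set X → ℝ) (hF : F ∅ = 0) :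
    ∑ B ∈ β, F B = ∑ A ∈ α, ∑ B ∈ cellsIn β A, F B := by
  classical
  rw [← Finset.sum_biUnion]
  · symm
    apply Finset.sum_subset
    · intro B hB
      obtain ⟨A, -, hB⟩ := Finset.mem_biUnion.1 hB
      exact ((mem_cellsIn_iff _ _ _).1 hB).1
    · intro B hB hn
      rcases B.eq_empty_or_nonempty with rfl | ⟨x, hx⟩
      · exact hF
      · exfalso
        apply hn
        have hxu : x ∈ ⋃₀ (α : Set (Set X)) := by rw [hα.2.2]; trivial
        obtain ⟨A, hA, hxA⟩ := hxu
        obtain ⟨B', hB', hxB'⟩ := exists_cell_of_mem href hA hxA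
        have := cell_eq_of_mem hβ hB ((mem_cellsIn_iff _ _ _).1 hB').1 hx hxB'
        subst this
        exact Finset.mem_biUnion.2 ⟨A, hA, hB'⟩
  · intro A hA A' hA' hne
    apply Finset.disjoint_left.2
    intro B hB hB'
    obtain ⟨-, ⟨x, hx⟩, hs⟩ := (mem_cellsIn_iff _ _ _).1 hB
    obtain ⟨-, -, hs'⟩ := (mem_cellsIn_iff _ _ _).1 hB'
    exact hne (cell_eq_of_mem hα hA hA' (hs hx) (hs' hx))

theorem measure_cells_eq (μ : Measure X) [IsProbabilityMeasure μ]
    {α β : Finset (Set X)} (hβ : IsFinPartition β)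
    (href : Refines β α) {A D : Set X} (hA : A ∈ α) (hD : MeasurableSet D) :
    (μ (A ∩ D)).toReal = ∑ B ∈ cellsIn β A, (μ (B ∩ D)).toReal := by
  have hU : A ∩ D = ⋃ B ∈ cellsIn β A, B ∩ D := by
    ext x
    simp only [Set.mem_iUnion, Set.mem_inter_iff, exists_prop]
    constructor
    · rintro ⟨hx, hd⟩
      obtain ⟨B, hB, hxB⟩ := exists_cell_of_mem href hA hx
      exact ⟨B, hB, hxB, hd⟩
    · rintro ⟨B, hB, hxB, hd⟩
      exact ⟨((mem_cellsIn_iff _ _ _).1 hB).2.2 hxB, hd⟩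
  rw [hU, measure_biUnion_finset, ENNReal.toReal_sum]
  · intro B _
    exact measure_ne_top _ _
  · intro B hB B' hB' hne
    exact (hβ.2.1 ((mem_cellsIn_iff _ _ _).1 hB).1 ((mem_cellsIn_iff _ _ _).1 hB').1 hne).mono
      Set.inter_subset_left Set.inter_subset_left
  · intro B hB
    exact (hβ.1 B ((mem_cellsIn_iff _ _ _).1 hB).1).inter hD

theorem term_le (μ : Measure X) [IsProbabilityMeasure μ] {A B D : Set X} (h : B ⊆ A) :
    (μ (B ∩ D)).toReal * Real.logb 2 ((μ (B ∩ D)).toReal / (μ D).toReal) ≤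
    (μ (B ∩ D)).toReal * Real.logb 2 ((μ (A ∩ D)).toReal / (μ D).toReal) := by
  rcases (ENNReal.toReal_nonneg (a := μ (B ∩ D))).eq_or_lt with h0 | h0
  · simp [← h0]
  · have hD : 0 < (μ D).toReal := h0.trans_le
      (ENNReal.toReal_mono (measure_ne_top _ _) (measure_mono Set.inter_subset_right))
    have hBA : (μ (B ∩ D)).toReal ≤ (μ (A ∩ D)).toReal :=
      ENNReal.toReal_mono (measure_ne_top _ _) (measure_mono (Set.inter_subset_inter_left _ h))
    apply mul_le_mul_of_nonneg_left _ h0.le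
    apply Real.logb_le_logb_of_le (by norm_num) (by positivity)
    gcongr

/-- If β refines α and some cell C of γ meets (in positive measure)
two distinct cells of β lying in the same cell of α, then H(α|γ) < H(β|γ). -/
theorem condEntropy_strict_mono_of_refines
    (μ : Measure X) [IsProbabilityMeasure μ]
    (α β γ : Finset (Set X))
    (hα : IsFinPartition α) (hβ : IsFinPartition β) (hγ : IsFinPartition γ)
    (href : Refines β α)
    (C : Set X) (hC : C ∈ γ)
    (B₁ B₂ : Set X) (hB₁ : B₁ ∈ β) (hB₂ : B₂ ∈ β) (hne : B₁ ≠ B₂)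
    (A : Set X) (hA : A ∈ α) (hB₁A : B₁ ⊆ A) (hB₂A : B₂ ⊆ A)
    (h₁ : 0 < μ (B₁ ∩ C)) (h₂ : 0 < μ (B₂ ∩ C)) :
    condEntropy μ α γ < condEntropy μ β γ := by
  have key : ∀ A ∈ α, ∀ D ∈ γ,
      (μ (A ∩ D)).toReal * Real.logb 2 ((μ (A ∩ D)).toReal / (μ D).toReal) =
      ∑ B ∈ cellsIn β A,
        (μ (B ∩ D)).toReal * Real.logb 2 ((μ (A ∩ D)).toReal / (μ D).toReal) := by
    intro A hA D hD
    rw [← Finset.sum_mul, ← measure_cells_eq μ hβ href hA (hγ.1 D hD)]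
  have hle : ∀ A ∈ α, ∀ D ∈ γ, ∑ B ∈ cellsIn β A,
      (μ (B ∩ D)).toReal * Real.logb 2 ((μ (B ∩ D)).toReal / (μ D).toReal) ≤
      (μ (A ∩ D)).toReal * Real.logb 2 ((μ (A ∩ D)).toReal / (μ D).toReal) := by
    intro A hA D hD
    rw [key A hA D hD]
    exact Finset.sum_le_sum fun B hB => term_le μ ((mem_cellsIn_iff _ _ _).1 hB).2.2
  have hm₁ : B₁ ∈ cellsIn β A := (mem_cellsIn_iff _ _ _).2
    ⟨hB₁, (nonempty_of_measure_ne_zero h₁.ne').mono Set.inter_subset_left, hB₁A⟩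
  have hm₂ : B₂ ∈ cellsIn β A := (mem_cellsIn_iff _ _ _).2
    ⟨hB₂, (nonempty_of_measure_ne_zero h₂.ne').mono Set.inter_subset_left, hB₂A⟩
  have p₁ : 0 < (μ (B₁ ∩ C)).toReal := ENNReal.toReal_pos h₁.ne' (measure_ne_top _ _)
  have p₂ : 0 < (μ (B₂ ∩ C)).toReal := ENNReal.toReal_pos h₂.ne' (measure_ne_top _ _)
  have hlt : ∑ B ∈ cellsIn β A,
      (μ (B ∩ C)).toReal * Real.logb 2 ((μ (B ∩ C)).toReal / (μ C).toReal) <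
      (μ (A ∩ C)).toReal * Real.logb 2 ((μ (A ∩ C)).toReal / (μ C).toReal) := by
    rw [key A hA C hC]
    refine Finset.sum_lt_sum (fun B hB => term_le μ ((mem_cellsIn_iff _ _ _).1 hB).2.2)
      ⟨B₁, hm₁, ?_⟩
    have hD : 0 < (μ C).toReal := p₁.trans_le
      (ENNReal.toReal_mono (measure_ne_top _ _) (measure_mono Set.inter_subset_right))
    have hBA : (μ (B₁ ∩ C)).toReal < (μ (A ∩ C)).toReal := by
      rw [measure_cells_eq μ hβ href hA (hγ.1 C hC)]
      exact Finset.single_lt_sum (f := fun B => (μ (B ∩ C)).toReal) hne.symm hm₁ hm₂ p₂ (fun _ _ _ => ENNReal.toReal_nonneg)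
    apply mul_lt_mul_of_pos_left _ p₁
    apply Real.logb_lt_logb (by norm_num) (by positivity)
    gcongr
  unfold condEntropy
  rw [neg_lt_neg_iff, sum_cells_eq hα hβ href _ (by simp)]
  apply Finset.sum_lt_sum
  · intro A hA
    rw [Finset.sum_comm]
    exact Finset.sum_le_sum (hle A hA)
  · refine ⟨A, hA, ?_⟩
    rw [Finset.sum_comm]
    exact Finset.sum_lt_sum (hle A hA) ⟨C, hC, hlt⟩
end

section
/- Let (X, μ) be a probability space, let α and β be finite measurable partitions of X, and let β' be the partition obtained from β by replacing one cell B ∈ β by two disjoint measurable sets B_a and B_b with B_a ∪ B_b = B and μ(B_a) > 0, μ(B_b) > 0. If there exists a cell A ∈ α with μ(A ∩ B_a) > 0 and μ(A ∩ B_b) = 0, then H(α|β') < H(α|β). -/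
open MeasureTheory Finset Real
open scoped Classical

variable {X : Type*} [MeasurableSpace X]

lemma aux_log_bound (x s p t : ℝ) (hx : 0 ≤ x) (hs : x ≤ s) (hp : 0 < p) (ht : 0 < t) :
    x * Real.log (s / t) - x * Real.log (x / p) ≤ s * p / t - x := by
  rcases hx.eq_or_lt with rfl | hx
  · simp only [zero_mul, sub_zero]
    positivity
  · have hs' : 0 < s := lt_of_lt_of_le hx hs
    have h := Real.log_le_sub_one_of_pos (show 0 < (s / t) / (x / p) by positivity)
    rw [Real.log_div (by positivity) (by positivity)] at h
    have h2 := mul_le_mul_of_nonneg_left h hx.le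
    have h3 : x * ((s / t) / (x / p) - 1) = s * p / t - x := by
      field_simp
    linarith

lemma aux_log_sum (x y p q : ℝ) (hx : 0 ≤ x) (hy : 0 ≤ y) (hp : 0 < p) (hq : 0 < q) :
    (x + y) * Real.logb 2 ((x + y) / (p + q))
      ≤ x * Real.logb 2 (x / p) + y * Real.logb 2 (y / q) := by
  have h1 := aux_log_bound x (x + y) p (p + q) hx (by linarith) hp (by linarith)
  have h2 := aux_log_bound y (x + y) q (p + q) hy (by linarith) hq (by linarith)
  have h3 : (x + y) * p / (p + q) + (x + y) * q / (p + q) = x + y := by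
    field_simp
  have h4 : (x + y) * Real.log ((x + y) / (p + q))
      ≤ x * Real.log (x / p) + y * Real.log (y / q) := by
    linarith
  have h5 : 0 < Real.log 2 := Real.log_pos (by norm_num)
  simp only [Real.logb, ← mul_div_assoc, ← add_div]
  gcongr

lemma aux_log_strict (x p q : ℝ) (hx : 0 < x) (hp : 0 < p) (hq : 0 < q) :
    x * Real.logb 2 (x / (p + q)) < x * Real.logb 2 (x / p) := by
  apply mul_lt_mul_of_pos_left _ hx
  apply Real.logb_lt_logb (by norm_num) (by positivity)
  apply div_lt_div_of_pos_left hx hp (by linarith)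

/-- Splitting a cell B of β into two positive-measure pieces Bₐ, B_b,
if some cell A of α meets Bₐ in positive measure but B_b in measure zero, then the
conditional entropy strictly decreases: H(α|β') < H(α|β). -/
theorem condEntropy_strict_decrease_of_split
    (μ : Measure X) [IsProbabilityMeasure μ]
    (α β : Finset (Set X))
    (hα : IsFinPartition α) (hβ : IsFinPartition β)
    (B Ba Bb : Set X) (hB : B ∈ β)
    (hmBa : MeasurableSet Ba) (hmBb : MeasurableSet Bb)
    (hdisj : Disjoint Ba Bb) (hunion : Ba ∪ Bb = B)
    (hBa : 0 < μ Ba) (hBb : 0 < μ Bb)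
    (β' : Finset (Set X)) (hβ' : β' = insert Ba (insert Bb (β.erase B)))
    (A : Set X) (hA : A ∈ α) (hABa : 0 < μ (A ∩ Ba)) (hABb : μ (A ∩ Bb) = 0) :
    condEntropy μ α β' < condEntropy μ α β := by
  subst hβ'
  have hneBa : Ba.Nonempty := nonempty_of_measure_ne_zero hBa.ne'
  have hneBb : Bb.Nonempty := nonempty_of_measure_ne_zero hBb.ne'
  have hnot : ∀ C : Set X, C.Nonempty → C ⊆ B → C ∉ β.erase B := by
    intro C hC hCB hmem
    rw [Finset.mem_erase] at hmem
    have hd : Disjoint C B := hβ.2.1 (Finset.mem_coe.2 hmem.2) (Finset.mem_coe.2 hB) hmem.1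
    obtain ⟨c, hc⟩ := hC
    exact Set.disjoint_left.1 hd hc (hCB hc)
  have hBbn : Bb ∉ β.erase B := hnot Bb hneBb (hunion ▸ Set.subset_union_right)
  have hBan : Ba ∉ insert Bb (β.erase B) := by
    rw [Finset.mem_insert, not_or]
    refine ⟨?_, hnot Ba hneBa (hunion ▸ Set.subset_union_left)⟩
    rintro rfl
    obtain ⟨c, hc⟩ := hneBa
    exact Set.disjoint_left.1 hdisj hc hc
  have hp : 0 < (μ Ba).toReal := ENNReal.toReal_pos hBa.ne' (measure_ne_top _ _)
  have hq : 0 < (μ Bb).toReal := ENNReal.toReal_pos hBb.ne' (measure_ne_top _ _)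
  have hsum : (μ B).toReal = (μ Ba).toReal + (μ Bb).toReal := by
    rw [← hunion, measure_union hdisj hmBb,
      ENNReal.toReal_add (measure_ne_top _ _) (measure_ne_top _ _)]
  have hsumA : ∀ C ∈ α, (μ (C ∩ B)).toReal = (μ (C ∩ Ba)).toReal + (μ (C ∩ Bb)).toReal := by
    intro C hC
    rw [← hunion, Set.inter_union_distrib_left,
      measure_union (hdisj.mono Set.inter_subset_right Set.inter_subset_right)
        ((hα.1 C hC).inter hmBb),
      ENNReal.toReal_add (measure_ne_top _ _) (measure_ne_top _ _)]
  unfold condEntropy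
  rw [neg_lt_neg_iff]
  apply Finset.sum_lt_sum
  · intro C hC
    rw [Finset.sum_insert hBan, Finset.sum_insert hBbn, ← Finset.add_sum_erase β _ hB,
      hsumA C hC, hsum]
    have := aux_log_sum (μ (C ∩ Ba)).toReal (μ (C ∩ Bb)).toReal _ _
      ENNReal.toReal_nonneg ENNReal.toReal_nonneg hp hq
    linarith
  · refine ⟨A, hA, ?_⟩
    rw [Finset.sum_insert hBan, Finset.sum_insert hBbn, ← Finset.add_sum_erase β _ hB,
      hsumA A hA, hsum, hABb]
    have := aux_log_strict (μ (A ∩ Ba)).toReal _ _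
      (ENNReal.toReal_pos hABa.ne' (measure_ne_top _ _)) hp hq
    simp only [ENNReal.toReal_zero, add_zero, zero_mul]
    linarith
end
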